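/- Let L be a 3-dimensional Lie algebra over a field F with [L,L] = L, and let L = L_α ⊕ L_β be a Lie grading with dim L_α = 1 and dim L_β = 2. Then [L_α, L_α] = 0, [L_α, L_β] = L_β and [L_β, L_β] = L_α; consequently the injective map φ : {α, β} → ℤ/2ℤ with φ(α) = 0̄, φ(β) = 1̄ satisfies property (P), so the grading is a group grading over ℤ/2ℤ. -/

import Mathlib

/-- The span of all brackets `⁅x, y⁆` with `x ∈ A`, `y ∈ B`: the product `[A, B]`
of two subspaces of a Lie algebra. -/
def bracketSpan (F : Type*) {L : Type*} [Field F] [LieRing L] [LieAlgebra F L]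
    (A B : Submodule F L) : Submodule F L :=
  Submodule.span F {z | ∃ x ∈ A, ∃ y ∈ B, z = ⁅x, y⁆}

/-- A Lie grading of the Lie algebra `L` over `F`: a family of nonzero subspaces,
whose sum is direct and equals `L`, such that for any pair of indices `g, g'` either
`[L_g, L_{g'}] = 0` or `0 ≠ [L_g, L_{g'}] ⊆ L_{g''}` for some index `g''`. -/
def IsLieGrading (F : Type*) {L : Type*} {G : Type*} [Field F] [LieRing L] [LieAlgebra F L]
    (Lg : G → Submodule F L) : Prop :=
  (∀ g, Lg g ≠ ⊥) ∧ iSupIndep Lg ∧ (⨆ g, Lg g) = ⊤ ∧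
    ∀ g g', bracketSpan F (Lg g) (Lg g') = ⊥ ∨
      ∃ g'', bracketSpan F (Lg g) (Lg g') ≠ ⊥ ∧ bracketSpan F (Lg g) (Lg g') ≤ Lg g''

/-- Property (P) for a map `φ` from the index set of a grading into a (multiplicative)
semigroup: `φ g * φ g' = φ g''` whenever `0 ≠ [L_g, L_{g'}] ⊆ L_{g''}`. -/
def PropertyP (F : Type*) {L G S : Type*} [Field F] [LieRing L] [LieAlgebra F L] [Semigroup S]
    (Lg : G → Submodule F L) (φ : G → S) : Prop :=
  ∀ g g' g'', bracketSpan F (Lg g) (Lg g') ≠ ⊥ → bracketSpan F (Lg g) (Lg g') ≤ Lg g'' →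
    φ g * φ g' = φ g''

/-- Property (P) for a map `φ` from the index set of a grading into an additive
semigroup: `φ g + φ g' = φ g''` whenever `0 ≠ [L_g, L_{g'}] ⊆ L_{g''}`. -/
def PropertyPAdd (F : Type*) {L G S : Type*} [Field F] [LieRing L] [LieAlgebra F L]
    [AddSemigroup S] (Lg : G → Submodule F L) (φ : G → S) : Prop :=
  ∀ g g' g'', bracketSpan F (Lg g) (Lg g') ≠ ⊥ → bracketSpan F (Lg g) (Lg g') ≤ Lg g'' →
    φ g + φ g' = φ g''

section BracketSpan

variable {F L : Type*} [Field F] [LieRing L] [LieAlgebra F L]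

lemma lie_mem_bracketSpan {A B : Submodule F L} {x y : L} (hx : x ∈ A) (hy : y ∈ B) :
    ⁅x, y⁆ ∈ bracketSpan F A B :=
  Submodule.subset_span ⟨x, hx, y, hy, rfl⟩

lemma bracketSpan_le {A B C : Submodule F L} :
    bracketSpan F A B ≤ C ↔ ∀ x ∈ A, ∀ y ∈ B, ⁅x, y⁆ ∈ C := by
  refine ⟨fun h x hx y hy => h (lie_mem_bracketSpan hx hy), fun h => Submodule.span_le.2 ?_⟩
  rintro _ ⟨x, hx, y, hy, rfl⟩
  exact h x hx y hy

lemma bracketSpan_comm (A B : Submodule F L) : bracketSpan F A B = bracketSpan F B A := by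
  have key : ∀ A B : Submodule F L, bracketSpan F A B ≤ bracketSpan F B A := fun A B =>
    bracketSpan_le.2 fun x hx y hy => by
      rw [← lie_skew]
      exact neg_mem (lie_mem_bracketSpan hy hx)
  exact le_antisymm (key A B) (key B A)

lemma bracketSpan_sup_self_le (A B : Submodule F L) :
    bracketSpan F (A ⊔ B) (A ⊔ B) ≤
      bracketSpan F A A ⊔ (bracketSpan F A B ⊔ bracketSpan F B B) := by
  refine bracketSpan_le.2 fun x hx y hy => ?_
  obtain ⟨a, ha, b, hb, rfl⟩ := Submodule.mem_sup.1 hx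
  obtain ⟨a', ha', b', hb', rfl⟩ := Submodule.mem_sup.1 hy
  have hAA : bracketSpan F A A ≤
      bracketSpan F A A ⊔ (bracketSpan F A B ⊔ bracketSpan F B B) := le_sup_left
  have hAB : bracketSpan F A B ≤
      bracketSpan F A A ⊔ (bracketSpan F A B ⊔ bracketSpan F B B) :=
    le_sup_left.trans le_sup_right
  have hBB : bracketSpan F B B ≤
      bracketSpan F A A ⊔ (bracketSpan F A B ⊔ bracketSpan F B B) :=
    le_sup_right.trans le_sup_right
  rw [add_lie, lie_add, lie_add]
  refine add_mem (add_mem (hAA (lie_mem_bracketSpan ha ha')) (hAB (lie_mem_bracketSpan ha hb')))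
    (add_mem (hAB ?_) (hBB (lie_mem_bracketSpan hb hb')))
  rw [bracketSpan_comm]
  exact lie_mem_bracketSpan hb ha'

lemma bracketSpan_self_eq_bot_of_finrank_eq_one {A : Submodule F L}
    (hA : Module.finrank F A = 1) : bracketSpan F A A = ⊥ := by
  obtain ⟨a, -, ha⟩ := finrank_eq_one_iff'.1 hA
  refine le_bot_iff.1 (bracketSpan_le.2 fun x hx y hy => ?_)
  obtain ⟨c, hc⟩ := ha ⟨x, hx⟩
  obtain ⟨d, hd⟩ := ha ⟨y, hy⟩
  obtain rfl : c • (a : L) = x := congrArg Subtype.val hc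
  obtain rfl : d • (a : L) = y := congrArg Subtype.val hd
  simp

lemma finrank_bracketSpan_le_of_finrank_eq_one [FiniteDimensional F L] {A : Submodule F L}
    (hA : Module.finrank F A = 1) (B : Submodule F L) :
    Module.finrank F (bracketSpan F A B) ≤ Module.finrank F B := by
  obtain ⟨a, -, ha⟩ := finrank_eq_one_iff'.1 hA
  have hle : bracketSpan F A B ≤ B.map (LieAlgebra.ad F L (a : L)) := by
    refine bracketSpan_le.2 fun x hx y hy => ?_
    obtain ⟨c, hc⟩ := ha ⟨x, hx⟩
    obtain rfl : c • (a : L) = x := congrArg Subtype.val hc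
    rw [smul_lie]
    exact Submodule.smul_mem _ _ ⟨y, hy, rfl⟩
  exact (Submodule.finrank_mono hle).trans (Submodule.finrank_map_le _ _)

lemma finrank_bracketSpan_self_le_one_of_finrank_eq_two [FiniteDimensional F L]
    {B : Submodule F L} (hB : Module.finrank F B = 2) :
    Module.finrank F (bracketSpan F B B) ≤ 1 := by
  let e := Module.finBasisOfFinrankEq F B hB
  have hrepr : ∀ x ∈ B, ∃ p q : F, x = p • (e 0 : L) + q • (e 1 : L) := fun x hx =>
    ⟨e.repr ⟨x, hx⟩ 0, e.repr ⟨x, hx⟩ 1, by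
      have h := e.sum_repr ⟨x, hx⟩
      rw [Fin.sum_univ_two] at h
      exact (congrArg Subtype.val h).symm⟩
  have hle : bracketSpan F B B ≤ Submodule.span F {⁅(e 0 : L), (e 1 : L)⁆} := by
    refine bracketSpan_le.2 fun x hx y hy => ?_
    obtain ⟨p, q, rfl⟩ := hrepr x hx
    obtain ⟨r, s, rfl⟩ := hrepr y hy
    refine Submodule.mem_span_singleton.2 ⟨p * s - q * r, ?_⟩
    simp only [add_lie, lie_add, smul_lie, lie_smul, lie_self, smul_zero]
    rw [← lie_skew (e 0 : L) (e 1 : L)]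
    module
  exact (Submodule.finrank_mono hle).trans ((finrank_span_le_card _).trans (by simp))

end BracketSpan

/-- A three-dimensional Lie algebra with `[L,L] = L`, graded with two components of
dimensions `1` and `2`: then `[L_α, L_α] = 0`, `[L_α, L_β] = L_β`, `[L_β, L_β] = L_α`,
and the injective map `α ↦ 0̄`, `β ↦ 1̄` into `ℤ/2ℤ` satisfies property (P), so the
grading is a group grading over `ℤ/2ℤ`. -/
theorem three_dim_perfect_case_a
    {F L : Type*} [Field F] [LieRing L] [LieAlgebra F L] [FiniteDimensional F L]
    (hdim : Module.finrank F L = 3)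
    (hperf : bracketSpan F (⊤ : Submodule F L) ⊤ = ⊤)
    (Lα Lβ : Submodule F L)
    (hgrad : IsLieGrading F ![Lα, Lβ])
    (hdimα : Module.finrank F Lα = 1) (hdimβ : Module.finrank F Lβ = 2) :
    bracketSpan F Lα Lα = ⊥ ∧ bracketSpan F Lα Lβ = Lβ ∧ bracketSpan F Lβ Lβ = Lα ∧
    Function.Injective (![0, 1] : Fin 2 → ZMod 2) ∧
    PropertyPAdd F ![Lα, Lβ] (![0, 1] : Fin 2 → ZMod 2) := by
  obtain ⟨-, -, hsup, hlie⟩ := hgrad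
  have hsup : Lα ⊔ Lβ = ⊤ := by
    refine top_le_iff.1 (hsup ▸ iSup_le fun g => ?_)
    fin_cases g
    exacts [le_sup_left, le_sup_right]
  have hαα : bracketSpan F Lα Lα = ⊥ := bracketSpan_self_eq_bot_of_finrank_eq_one hdimα
  have hspan : bracketSpan F Lα Lβ ⊔ bracketSpan F Lβ Lβ = ⊤ := by
    have h := bracketSpan_sup_self_le Lα Lβ
    rwa [hsup, hperf, hαα, bot_sup_eq, top_le_iff] at h
  have hX := finrank_bracketSpan_le_of_finrank_eq_one hdimα Lβ
  have hY := finrank_bracketSpan_self_le_one_of_finrank_eq_two hdimβ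
  have hXY := Submodule.finrank_add_le_finrank_add_finrank
    (bracketSpan F Lα Lβ) (bracketSpan F Lβ Lβ)
  rw [hspan, finrank_top, hdim] at hXY
  have hle : ∀ g g' : Fin 2, ∃ g'', bracketSpan F (![Lα, Lβ] g) (![Lα, Lβ] g') ≤
      ![Lα, Lβ] g'' := fun g g' =>
    (hlie g g').elim (fun h => ⟨0, h ▸ bot_le⟩) fun ⟨g'', h⟩ => ⟨g'', h.2⟩
  have hαβ : bracketSpan F Lα Lβ = Lβ := by
    obtain ⟨g, hg⟩ := hle 0 1
    fin_cases g
    · have := Submodule.finrank_mono (show bracketSpan F Lα Lβ ≤ Lα from hg)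
      omega
    · exact Submodule.eq_of_le_of_finrank_le hg (by omega)
  have hββ : bracketSpan F Lβ Lβ = Lα := by
    obtain ⟨g, hg⟩ := hle 1 1
    fin_cases g
    · exact Submodule.eq_of_le_of_finrank_le hg (by omega)
    · have := Submodule.finrank_mono
        (show ⊤ ≤ Lβ from hspan ▸ sup_le hαβ.le hg)
      rw [finrank_top] at this
      omega
  have hβα : bracketSpan F Lβ Lα = Lβ := bracketSpan_comm Lβ Lα ▸ hαβ
  have hβ_not_le : ¬ Lβ ≤ Lα := fun h => by
    have := Submodule.finrank_mono h
    omega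
  have hα_not_le : ¬ Lα ≤ Lβ := fun h => by
    have := Submodule.finrank_mono (show ⊤ ≤ Lβ from hsup ▸ sup_le h le_rfl)
    rw [finrank_top] at this
    omega
  refine ⟨hαα, hαβ, hββ, by decide, fun g g' g'' hne h => ?_⟩
  fin_cases g <;> fin_cases g' <;> fin_cases g'' <;>
    simp_all
  decide
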